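/- Define F(r) = (2E(r) − r'² K(r))² · [1 + (π² − 4(2E(r) − r'² K(r))²)/(π² r²)] for r ∈ (0,1). Then F is strictly increasing on (0,1), with limit π²/8 as r → 0⁺ and limit 8(π² − 8)/π² as r → 1⁻ (so it maps (0,1) onto (π²/8, 8(π² − 8)/π²)). -/

import Mathlib

open Real Set Filter Topology

/-- The complete elliptic integral of the second kind. -/
noncomputable def ellipticE (r : ℝ) : ℝ :=
  ∫ θ in (0:ℝ)..(π/2), Real.sqrt (1 - r^2 * Real.sin θ ^ 2)

/-- The complete elliptic integral of the first kind. -/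
noncomputable def ellipticK (r : ℝ) : ℝ :=
  ∫ θ in (0:ℝ)..(π/2), (1 - r^2 * Real.sin θ ^ 2) ^ (-(1:ℝ)/2)

noncomputable def JJ (p : ℝ) (g : ℝ → ℝ) (x : ℝ) : ℝ :=
  ∫ θ in (0:ℝ)..(π/2), g θ * (1 - x * Real.sin θ ^ 2) ^ p

lemma dpos {x : ℝ} (hx : x < 1) (θ : ℝ) : 0 < 1 - x * Real.sin θ ^ 2 := by
  have h1 := Real.sin_sq_le_one θ
  have h2 := sq_nonneg (Real.sin θ)
  by_cases h : x ≤ 0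
  · nlinarith
  · push Not at h
    nlinarith

lemma contI (p : ℝ) {g : ℝ → ℝ} (hg : Continuous g) {x : ℝ} (hx : x < 1) :
    Continuous (fun θ => g θ * (1 - x * Real.sin θ ^ 2) ^ p) := by
  refine hg.mul (Continuous.rpow_const (by fun_prop) fun θ => Or.inl (dpos hx θ).ne')

lemma JJ_int (p : ℝ) {g : ℝ → ℝ} (hg : Continuous g) {x : ℝ} (hx : x < 1) :
    IntervalIntegrable (fun θ => g θ * (1 - x * Real.sin θ ^ 2) ^ p) MeasureTheory.volume 0 (π/2) :=
  (contI p hg hx).intervalIntegrable _ _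

lemma JJ_deriv (p : ℝ) {g : ℝ → ℝ} (hg : Continuous g) {x : ℝ} (hx : x < 1) :
    HasDerivAt (JJ p g) (JJ (p-1) (fun θ => g θ * (-p * Real.sin θ ^ 2)) x) x := by
  set b := (x+1)/2 with hb
  have hxb : x < b := by linarith
  have hb1 : b < 1 := by linarith
  have hg' : Continuous (fun θ => g θ * (-p * Real.sin θ ^ 2)) := by fun_prop
  have hc : ContinuousOn (fun q : ℝ × ℝ => (g q.2 * (-p * Real.sin q.2 ^ 2)) * (1 - q.1 * Real.sin q.2 ^ 2) ^ (p-1))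
      (Icc (x-1) b ×ˢ Icc 0 (π/2)) := by
    refine ContinuousOn.mul (by fun_prop) (ContinuousOn.rpow_const (by fun_prop) ?_)
    intro q hq
    exact Or.inl (dpos (lt_of_le_of_lt hq.1.2 hb1) _).ne'
  obtain ⟨C, hC⟩ := (isCompact_Icc.prod isCompact_Icc).exists_bound_of_continuousOn hc
  have hpi : (0:ℝ) ≤ π/2 := by positivity
  refine (intervalIntegral.hasDerivAt_integral_of_dominated_loc_of_deriv_le
    (F := fun x θ => g θ * (1 - x * Real.sin θ ^ 2) ^ p)
    (F' := fun x θ => (g θ * (-p * Real.sin θ ^ 2)) * (1 - x * Real.sin θ ^ 2) ^ (p-1))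
    (bound := fun _ => C) (s := Ioo (x-1) b) (Ioo_mem_nhds (by linarith) hxb) ?_ (JJ_int p hg hx)
    ?_ ?_ ?_ ?_).2
  · filter_upwards [Iio_mem_nhds hx] with y hy
    exact (contI p hg hy).aestronglyMeasurable
  · exact (contI (p-1) hg' hx).aestronglyMeasurable
  · refine Eventually.of_forall fun θ hθ y hy => ?_
    rw [uIoc_of_le hpi] at hθ
    exact hC (y, θ) ⟨⟨hy.1.le, hy.2.le⟩, ⟨hθ.1.le, hθ.2⟩⟩
  · simp
  · refine Eventually.of_forall fun θ hθ y hy => ?_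
    have h1 : HasDerivAt (fun y => 1 - y * Real.sin θ ^ 2) (-(Real.sin θ ^ 2)) y := by
      simpa using ((hasDerivAt_id y).mul_const (Real.sin θ ^ 2)).const_sub 1
    have h2 := (h1.rpow_const (p := p) (Or.inl (dpos (hy.2.trans hb1) θ).ne')).const_mul (g θ)
    refine HasDerivAt.congr_deriv h2 ?_
    ring

lemma JJ_mono {p : ℝ} (hp : p ≤ 0) {g : ℝ → ℝ} (hg : Continuous g) (hg0 : ∀ θ, 0 ≤ g θ) {x y : ℝ}
    (hxy : x ≤ y) (hy : y < 1) : JJ p g x ≤ JJ p g y := by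
  refine intervalIntegral.integral_mono_on (by positivity) (JJ_int p hg (by linarith)) (JJ_int p hg hy) ?_
  intro θ _
  refine mul_le_mul_of_nonneg_left ?_ (hg0 θ)
  refine Real.rpow_le_rpow_of_nonpos (dpos hy θ) ?_ hp
  nlinarith [sq_nonneg (Real.sin θ)]

lemma JJ_nonneg {p : ℝ} {g : ℝ → ℝ} (hg0 : ∀ θ, 0 ≤ g θ) {x : ℝ}
    (hx : x < 1) : 0 ≤ JJ p g x := by
  refine intervalIntegral.integral_nonneg (by positivity) ?_
  intro θ _
  exact mul_nonneg (hg0 θ) (Real.rpow_nonneg (dpos hx θ).le _)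

noncomputable def WW (x : ℝ) : ℝ := 2 * JJ (1/2) (fun _ => 1) x - (1 - x) * JJ (-1/2) (fun _ => 1) x
noncomputable def VV (x : ℝ) : ℝ := 1/2 * JJ (-1/2) (fun θ => Real.cos θ ^ 2) x
noncomputable def UU (x : ℝ) : ℝ := 1/2 * JJ (-1/2-1) (fun θ => Real.cos θ ^ 2 * (-(-1/2) * Real.sin θ ^ 2)) x

lemma hV {x : ℝ} (hx : x < 1) : HasDerivAt VV (UU x) x :=
  (JJ_deriv (-1/2) (g := fun θ => Real.cos θ ^ 2) (by fun_prop) hx).const_mul (1/2)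

lemma key0 {x : ℝ} (hx : x < 1) :
    JJ (-1/2) (fun θ => Real.cos θ ^ 2) x - (1 - x) * JJ (-3/2) (fun θ => Real.sin θ ^ 2) x = 0 := by
  have h : ∀ θ ∈ uIcc 0 (π/2), HasDerivAt
      (fun θ => (Real.sin θ * Real.cos θ) * (1 - x * Real.sin θ ^ 2) ^ (-1/2 : ℝ))
      (Real.cos θ ^ 2 * (1 - x * Real.sin θ ^ 2) ^ (-1/2 : ℝ)
        - (1 - x) * (Real.sin θ ^ 2 * (1 - x * Real.sin θ ^ 2) ^ (-3/2 : ℝ))) θ := by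
    intro θ _
    have hd := dpos hx θ
    have h1 : HasDerivAt (fun θ => 1 - x * Real.sin θ ^ 2) (-(x * (2 * Real.sin θ * Real.cos θ))) θ := by
      simpa using (((Real.hasDerivAt_sin θ).pow 2).const_mul x).const_sub 1
    have h2 := h1.rpow_const (p := (-1/2 : ℝ)) (Or.inl hd.ne')
    have h3 := ((Real.hasDerivAt_sin θ).mul (Real.hasDerivAt_cos θ)).mul h2
    refine HasDerivAt.congr_deriv h3 ?_
    have e1 : (1 - x * Real.sin θ ^ 2) ^ (-1/2 : ℝ)
        = (1 - x * Real.sin θ ^ 2) ^ (-3/2 : ℝ) * (1 - x * Real.sin θ ^ 2) := by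
      rw [← Real.rpow_add_one hd.ne']; norm_num
    have e2 : (-1/2 - 1 : ℝ) = -3/2 := by norm_num
    rw [e2, e1]
    have e3 := Real.sin_sq_add_cos_sq θ
    have e4 : Real.cos θ ^ 2 = 1 - Real.sin θ ^ 2 := by linarith
    simp only [Pi.mul_apply]
    ring_nf
    have e5 : Real.cos θ ^ 2 = 1 - Real.sin θ ^ 2 := by linarith
    simp only [e5]
    ring
  have i1 := JJ_int (-1/2) (g := fun θ => Real.cos θ ^ 2) (by fun_prop) hx
  have i2 := (JJ_int (-3/2) (g := fun θ => Real.sin θ ^ 2) (by fun_prop) hx).const_mul (1 - x)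
  have := intervalIntegral.integral_eq_sub_of_hasDerivAt h (i1.sub i2)
  rw [intervalIntegral.integral_sub i1 i2, intervalIntegral.integral_const_mul] at this
  unfold JJ
  rw [this]
  simp

lemma hA {x : ℝ} (hx : x < 1) :
    2 * x * VV x = JJ (1/2) (fun _ => 1) x - (1 - x) * JJ (-1/2) (fun _ => 1) x := by
  unfold VV JJ
  have i1 := JJ_int (1/2) (g := fun _ => 1) (by fun_prop) hx
  have i2 := (JJ_int (-1/2) (g := fun _ => 1) (by fun_prop) hx).const_mul (1-x)
  rw [← intervalIntegral.integral_const_mul (1-x), ← intervalIntegral.integral_sub i1 i2,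
    ← intervalIntegral.integral_const_mul, ← intervalIntegral.integral_const_mul]
  congr 1
  ext θ
  have hd := dpos hx θ
  have e1 : (1 - x * Real.sin θ ^ 2) ^ (1/2 : ℝ)
        = (1 - x * Real.sin θ ^ 2) ^ (-1/2 : ℝ) * (1 - x * Real.sin θ ^ 2) := by
      rw [← Real.rpow_add_one hd.ne']; norm_num
  simp only [e1, Real.cos_sq']
  ring

lemma hW {x : ℝ} (hx : x < 1) : HasDerivAt WW (VV x) x := by
  have h1 := (JJ_deriv (1/2) (g := fun _ => 1) (by fun_prop) hx).const_mul 2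
  have h2 := JJ_deriv (-1/2) (g := fun _ => 1) (by fun_prop) hx
  have h3 := h1.sub (((hasDerivAt_id x).const_sub 1).mul h2)
  refine HasDerivAt.congr_deriv h3 ?_
  have k := key0 hx
  have e1 : JJ (1/2-1) (fun θ => 1 * (-(1/2) * Real.sin θ ^ 2)) x =
      -(1/2) * (JJ (-1/2) (fun _ => 1) x - JJ (-1/2) (fun θ => Real.cos θ ^ 2) x) := by
    have i1 := JJ_int (-1/2) (g := fun _ => 1) (by fun_prop) hx
    have i2 := JJ_int (-1/2) (g := fun θ => Real.cos θ ^ 2) (by fun_prop) hx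
    unfold JJ
    rw [← intervalIntegral.integral_sub i1 i2, ← intervalIntegral.integral_const_mul]
    congr 1
    ext θ
    rw [Real.cos_sq']
    norm_num
    ring
  have e2 : JJ (-1/2-1) (fun θ => 1 * (-(-1/2) * Real.sin θ ^ 2)) x =
      (1/2) * JJ (-3/2) (fun θ => Real.sin θ ^ 2) x := by
    unfold JJ
    rw [← intervalIntegral.integral_const_mul]
    congr 1
    ext θ
    norm_num
    ring
  rw [e1, e2]
  simp only [id, VV]
  linarith

lemma VV_zero : VV 0 = π/8 := by
  simp [VV, JJ, integral_cos_sq]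
  ring

lemma WW_zero : WW 0 = π/2 := by
  simp [WW, JJ]
  ring

lemma VV_mono {x y : ℝ} (h : x ≤ y) (hy : y < 1) : VV x ≤ VV y := by
  have := JJ_mono (p := -1/2) (by norm_num) (g := fun θ => Real.cos θ ^ 2) (by fun_prop) (fun θ => sq_nonneg _) h hy
  unfold VV; linarith

lemma UU_mono {x y : ℝ} (h : x ≤ y) (hy : y < 1) : UU x ≤ UU y := by
  have := JJ_mono (p := -1/2-1) (by norm_num) (g := fun θ => Real.cos θ ^ 2 * (-(-1/2) * Real.sin θ ^ 2)) (by fun_prop) (fun θ => by positivity) h hy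
  unfold UU; linarith

lemma UU_nonneg {x : ℝ} (hx : x < 1) : 0 ≤ UU x := by
  have := JJ_nonneg (p := -1/2-1) (g := fun θ => Real.cos θ ^ 2 * (-(-1/2) * Real.sin θ ^ 2)) (fun θ => by positivity) hx
  unfold UU; linarith

lemma VV_ge {x : ℝ} (h0 : 0 ≤ x) (hx : x < 1) : π/8 ≤ VV x := VV_zero ▸ VV_mono h0 hx

lemma WW_smono : StrictMonoOn WW (Ico 0 1) := by
  refine strictMonoOn_of_hasDerivWithinAt_pos (f' := VV) (convex_Ico 0 1)
    (fun x hx => (hW hx.2).continuousAt.continuousWithinAt) ?_ ?_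
  · intro x hx
    rw [interior_Ico] at hx
    exact (hW hx.2).hasDerivWithinAt
  · intro x hx
    rw [interior_Ico] at hx
    have := VV_ge hx.1.le hx.2
    have := Real.pi_pos
    linarith

lemma WW_ge {x : ℝ} (h0 : 0 ≤ x) (hx : x < 1) : π/2 ≤ WW x :=
  WW_zero ▸ WW_smono.monotoneOn ⟨le_rfl, one_pos⟩ ⟨h0, hx⟩ h0

lemma E_tend : Tendsto (JJ (1/2) (fun _ => 1)) (𝓝[<] 1) (𝓝 1) := by
  have hc : Continuous (JJ (1/2) (fun _ => 1)) := by
    unfold JJ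
    refine intervalIntegral.continuous_parametric_intervalIntegral_of_continuous' ?_ _ _
    refine Continuous.mul (by fun_prop) (Continuous.rpow_const (by fun_prop) fun q => Or.inr (by norm_num))
  have h1 : JJ (1/2) (fun _ => 1) 1 = 1 := by
    unfold JJ
    have : ∫ θ in (0:ℝ)..(π/2), Real.cos θ = 1 := by simp
    refine Eq.trans ?_ this
    refine intervalIntegral.integral_congr ?_
    intro θ hθ
    rw [uIcc_of_le (by positivity)] at hθ
    have : 0 ≤ Real.cos θ := Real.cos_nonneg_of_mem_Icc ⟨by linarith [hθ.1, Real.pi_pos], hθ.2⟩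
    simp only [one_mul]
    rw [← Real.cos_sq', ← Real.sqrt_eq_rpow, Real.sqrt_sq this]
  have := hc.tendsto 1
  rw [h1] at this
  exact this.mono_left nhdsWithin_le_nhds

lemma K_tend : Tendsto (fun x => (1 - x) * JJ (-1/2) (fun _ => 1) x) (𝓝[<] 1) (𝓝 0) := by
  have hc : Tendsto (fun x : ℝ => π/2 * √(1-x)) (𝓝[<] 1) (𝓝 0) := by
    have : Continuous (fun x : ℝ => π/2 * √(1-x)) := by fun_prop
    have := this.tendsto 1
    simp only [sub_self, Real.sqrt_zero, mul_zero] at this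
    exact this.mono_left nhdsWithin_le_nhds
  refine tendsto_of_tendsto_of_tendsto_of_le_of_le' tendsto_const_nhds hc ?_ ?_
  · filter_upwards [self_mem_nhdsWithin] with x hx
    exact mul_nonneg (by linarith [mem_Iio.1 hx]) (JJ_nonneg (fun _ => zero_le_one) hx)
  · filter_upwards [Ioo_mem_nhdsLT (show (0:ℝ) < 1 by norm_num)] with x hx
    have h1 : 0 < 1 - x := by linarith [hx.2]
    have : JJ (-1/2) (fun _ => 1) x ≤ ∫ θ in (0:ℝ)..(π/2), (1-x)^(-1/2:ℝ) := by
      refine intervalIntegral.integral_mono_on (by positivity) (JJ_int _ (by fun_prop) hx.2) (by simp) ?_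
      intro θ _
      rw [one_mul]
      refine Real.rpow_le_rpow_of_nonpos h1 ?_ (by norm_num)
      nlinarith [Real.sin_sq_le_one θ, hx.1]
    rw [intervalIntegral.integral_const, smul_eq_mul, sub_zero] at this
    have e : (1-x) * (1-x)^(-1/2:ℝ) = √(1-x) := by
      rw [Real.sqrt_eq_rpow, mul_comm, ← Real.rpow_add_one h1.ne']; norm_num
    calc _ ≤ (1-x) * (π/2 * (1-x)^(-1/2:ℝ)) := mul_le_mul_of_nonneg_left this h1.le
      _ = _ := by rw [← e]; ring

lemma W_tend : Tendsto WW (𝓝[<] 1) (𝓝 2) := by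
  have := (E_tend.const_mul 2).sub K_tend
  rw [mul_one, sub_zero] at this
  exact this

lemma xV_tend : Tendsto (fun x => 2 * x * VV x) (𝓝[<] 1) (𝓝 1) := by
  have := E_tend.sub K_tend
  rw [sub_zero] at this
  refine this.congr' ?_
  filter_upwards [self_mem_nhdsWithin] with x hx
  exact (hA hx).symm

/- P = c w², c = 4/π² -/
noncomputable def PP (x : ℝ) : ℝ := 4/π^2 * WW x ^ 2
noncomputable def PP1 (x : ℝ) : ℝ := 4/π^2 * (2 * (WW x * VV x))
noncomputable def PP2 (x : ℝ) : ℝ := 4/π^2 * (2 * (VV x * VV x + WW x * UU x))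
noncomputable def DD (x : ℝ) : ℝ := PP x * (PP x - 1) - x * PP1 x * (2 * PP x - 1 - x)
noncomputable def MM (x : ℝ) : ℝ := 2 * (PP1 x * (1 - PP1 x)) - PP2 x * (2 * PP x - 1 - x)

lemma hP {x : ℝ} (hx : x < 1) : HasDerivAt PP (PP1 x) x := by
  refine HasDerivAt.congr_deriv (((hW hx).pow 2).const_mul (4/π^2)) ?_
  simp [PP1]; ring

lemma hP1 {x : ℝ} (hx : x < 1) : HasDerivAt PP1 (PP2 x) x := 
  (((hW hx).mul (hV hx)).const_mul 2).const_mul (4/π^2)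

lemma hD {x : ℝ} (hx : x < 1) : HasDerivAt DD (x * MM x) x := by
  have h1 := (hP hx).mul ((hP hx).sub_const 1)
  have h2 := ((hasDerivAt_id x).mul (hP1 hx)).mul ((((hP hx).const_mul 2).sub_const 1).sub (hasDerivAt_id x))
  refine HasDerivAt.congr_deriv (h1.sub h2) ?_
  simp [MM]; ring

lemma cpos : 0 < 4/π^2 := by positivity

lemma PP1_smono : StrictMonoOn PP1 (Ico 0 1) := by
  intro x hx y hy h
  have h1 := WW_smono hx hy h
  have h2 := VV_mono h.le hy.2
  have h3 := VV_ge hx.1 hx.2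
  have h4 := WW_ge hx.1 hx.2
  have h5 := Real.pi_pos
  have : WW x * VV x < WW y * VV y := by nlinarith
  exact mul_lt_mul_of_pos_left (by linarith) cpos

lemma PP1_zero : PP1 0 = 1/2 := by
  have := Real.pi_pos
  rw [PP1, WW_zero, VV_zero]; field_simp; norm_num

lemma PP_zero : PP 0 = 1 := by
  have := Real.pi_pos
  rw [PP, WW_zero]; field_simp; norm_num

lemma PP1_ge {x : ℝ} (h0 : 0 ≤ x) (hx : x < 1) : 1/2 ≤ PP1 x :=
  PP1_zero ▸ PP1_smono.monotoneOn ⟨le_rfl, one_pos⟩ ⟨h0, hx⟩ h0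

lemma PP2_mono {x y : ℝ} (h0 : 0 ≤ x) (h : x ≤ y) (hy : y < 1) : PP2 x ≤ PP2 y := by
  have hx : x < 1 := by linarith
  have h1 := WW_smono.monotoneOn ⟨h0, hx⟩ ⟨h0.trans h, hy⟩ h
  have h2 := VV_mono h hy
  have h3 := VV_ge h0 hx
  have h4 := WW_ge h0 hx
  have h5 := Real.pi_pos
  have h6 := UU_mono h hy
  have h7 := UU_nonneg hx
  have : VV x * VV x + WW x * UU x ≤ VV y * VV y + WW y * UU y := by
    gcongr <;> linarith
  exact mul_le_mul_of_nonneg_left (by linarith) cpos.le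

lemma PP2_nonneg {x : ℝ} (h0 : 0 ≤ x) (hx : x < 1) : 0 ≤ PP2 x := by
  have h4 := WW_ge h0 hx
  have h5 := Real.pi_pos
  have h7 := UU_nonneg hx
  have h8 : 0 ≤ WW x := by linarith
  unfold PP2
  have := mul_self_nonneg (VV x)
  positivity

lemma lin_mono : MonotoneOn (fun x => 2 * PP x - 1 - x) (Ico 0 1) := by
  have hd : ∀ x : ℝ, x < 1 → HasDerivAt (fun x => 2 * PP x - 1 - x) (2 * PP1 x - 1) x := fun x hx =>
    (((hP hx).const_mul 2).sub_const 1).sub (hasDerivAt_id x)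
  refine monotoneOn_of_hasDerivWithinAt_nonneg (f' := fun x => 2 * PP1 x - 1) (convex_Ico 0 1)
    (fun x hx => (hd x hx.2).continuousAt.continuousWithinAt) ?_ ?_
  · intro x hx
    rw [interior_Ico] at hx
    exact (hd x hx.2).hasDerivWithinAt
  · intro x hx
    rw [interior_Ico] at hx
    have := PP1_ge hx.1.le hx.2
    linarith

lemma MM_anti : StrictAntiOn MM (Ico 0 1) := by
  intro x hx y hy h
  have h1 := PP1_smono hx hy h
  have h2 := PP1_ge hx.1 hx.2
  have h3 := PP2_mono hx.1 h.le hy.2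
  have h4 := PP2_nonneg hx.1 hx.2
  have h5 : 2 * PP x - 1 - x ≤ 2 * PP y - 1 - y := lin_mono hx hy h.le
  have h6 : 2 * PP 0 - 1 - 0 ≤ 2 * PP x - 1 - x := lin_mono ⟨le_rfl, one_pos⟩ hx hx.1
  rw [PP_zero] at h6
  have h7 : PP2 x * (2 * PP x - 1 - x) ≤ PP2 y * (2 * PP y - 1 - y) := by
    gcongr <;> linarith
  unfold MM
  nlinarith

lemma DD_tend : Tendsto DD (𝓝[<] 1) (𝓝 0) := by
  have hP : Tendsto PP (𝓝[<] 1) (𝓝 (4/π^2 * 2^2)) := (W_tend.pow 2).const_mul _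
  have h1 : Tendsto (fun x => x * PP1 x) (𝓝[<] 1) (𝓝 (4/π^2 * (2 * 1))) := by
    refine ((W_tend.mul xV_tend).const_mul (4/π^2)).congr fun x => ?_
    unfold PP1; ring
  have hid : Tendsto (fun x : ℝ => x) (𝓝[<] 1) (𝓝 1) := tendsto_id.mono_left nhdsWithin_le_nhds
  have := (hP.mul (hP.sub_const 1)).sub (h1.mul (((hP.const_mul 2).sub_const 1).sub hid))
  refine (this.congr fun x => rfl).mono_right (le_of_eq ?_)
  ring_nf

lemma DD_pos {x : ℝ} (hx : x ∈ Ioo (0:ℝ) 1) : 0 < DD x := by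
  by_contra! hneg
  have h0 : DD 0 = 0 := by simp [DD, PP_zero]
  obtain ⟨c, hc, hce⟩ := exists_hasDerivAt_eq_slope DD (fun x => x * MM x) hx.1
    (fun y hy => (hD (lt_of_le_of_lt hy.2 hx.2)).continuousAt.continuousWithinAt)
    (fun y hy => hD (hy.2.trans hx.2))
  have hc1 := hc.2.trans hx.2
  have hM : MM c ≤ 0 := by
    rw [h0] at hce
    have h3 : c * MM c ≤ 0 := by
      rw [hce]
      exact div_nonpos_of_nonpos_of_nonneg (by linarith) (by linarith [hx.1])
    by_contra! h
    have := mul_pos hc.1 h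
    linarith
  have hanti : StrictAntiOn DD (Ico x 1) := by
    refine strictAntiOn_of_hasDerivWithinAt_neg (f' := fun x => x * MM x) (convex_Ico x 1)
      (fun x hx => (hD hx.2).continuousAt.continuousWithinAt) ?_ ?_
    · intro x hx
      rw [interior_Ico] at hx
      exact (hD hx.2).hasDerivWithinAt
    · intro y hy
      rw [interior_Ico] at hy
      have := MM_anti ⟨hc.1.le, hc1⟩ ⟨(hx.1.trans hy.1).le, hy.2⟩ (hc.2.trans hy.1)
      exact mul_neg_of_pos_of_neg (hx.1.trans hy.1) (by linarith)
  obtain ⟨z, hz⟩ := exists_between hx.2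
  have h1 : DD z < DD x := hanti ⟨le_rfl, hx.2⟩ ⟨hz.1.le, hz.2⟩ hz.1
  have h2 : (0:ℝ) ≤ DD z := by
    refine le_of_tendsto DD_tend ?_
    filter_upwards [Ioo_mem_nhdsLT hz.2] with y hy
    exact hanti.antitoneOn ⟨hz.1.le, hz.2⟩ ⟨(hz.1.trans hy.1).le, hy.2⟩ hy.1.le
  linarith

noncomputable def HH (x : ℝ) : ℝ := π^2/4 * (PP x * (1 + (1 - PP x) / x))

lemma HH_smono : StrictMonoOn HH (Ioo 0 1) := by
  have hd : ∀ x ∈ Ioo (0:ℝ) 1, HasDerivAt HH (π^2/4 * (DD x / x^2)) x := by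
    intro x hx
    have h := ((hP hx.2).mul ((((hP hx.2).const_sub 1).div (hasDerivAt_id x) hx.1.ne').const_add 1)).const_mul (π^2/4)
    refine HasDerivAt.congr_deriv h ?_
    have := hx.1.ne'
    congr 1
    simp only [DD, id, Pi.div_apply]
    field_simp
    ring
  refine strictMonoOn_of_hasDerivWithinAt_pos (f' := fun x => π^2/4 * (DD x / x^2)) (convex_Ioo 0 1)
    (fun x hx => (hd x hx).continuousAt.continuousWithinAt) ?_ ?_
  · intro x hx
    rw [interior_Ioo] at hx
    exact (hd x hx).hasDerivWithinAt
  · intro x hx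
    rw [interior_Ioo] at hx
    have := DD_pos hx
    have := hx.1
    positivity

lemma HH_zero : Tendsto HH (𝓝[>] 0) (𝓝 (π^2/8)) := by
  have h1 : Tendsto PP (𝓝[>] 0) (𝓝 1) := by
    have := (hP (x := 0) one_pos).continuousAt.tendsto
    rw [PP_zero] at this
    exact this.mono_left nhdsWithin_le_nhds
  have h2 := (hasDerivAt_iff_tendsto_slope.1 (hP (x := 0) one_pos)).mono_left
    (nhdsWithin_mono 0 (show Ioi (0:ℝ) ⊆ {0}ᶜ from fun y hy => ne_of_gt hy))
  rw [PP1_zero] at h2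
  have h3 := (h1.mul (h2.const_sub 1)).const_mul (π^2/4)
  have : π^2/8 = π^2/4 * (1 * (1 - 1/2)) := by ring
  rw [this]
  refine h3.congr fun x => ?_
  simp only [HH, slope_def_field, PP_zero, sub_zero]
  ring

lemma HH_one : Tendsto HH (𝓝[<] 1) (𝓝 (8 * (π^2 - 8) / π^2)) := by
  have hP : Tendsto PP (𝓝[<] 1) (𝓝 (4/π^2 * 2^2)) := (W_tend.pow 2).const_mul _
  have hid : Tendsto (fun x : ℝ => x) (𝓝[<] 1) (𝓝 1) := tendsto_id.mono_left nhdsWithin_le_nhds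
  have := (hP.mul (((hP.const_sub 1).div hid one_ne_zero).const_add 1)).const_mul (π^2/4)
  refine (this.congr fun x => rfl).mono_right (le_of_eq ?_)
  congr 1
  have := Real.pi_pos
  field_simp
  ring

lemma F_eq : (fun r : ℝ => (2 * ellipticE r - (1 - r^2) * ellipticK r)^2 *
        (1 + (π^2 - 4 * (2 * ellipticE r - (1 - r^2) * ellipticK r)^2) / (π^2 * r^2))) =
    fun r => HH (r^2) := by
  ext r
  have hE : ellipticE r = JJ (1/2) (fun _ => 1) (r^2) := by
    simp [ellipticE, JJ, Real.sqrt_eq_rpow]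
  have hK : ellipticK r = JJ (-1/2) (fun _ => 1) (r^2) := by
    simp [ellipticK, JJ]
  have hw : 2 * ellipticE r - (1 - r^2) * ellipticK r = WW (r^2) := by rw [hE, hK, WW]
  rw [hw, HH, PP]
  have := Real.pi_pos
  by_cases hr : r = 0
  · simp [hr]; field_simp
  · field_simp

/-- Lemma 2.7: F(r) = (2E − r'²K)²[1 + (π² − 4(2E − r'²K)²)/(π²r²)] is strictly
increasing from (0,1) onto (π²/8, 8(π² − 8)/π²). -/
theorem stmt_14 :
    StrictMonoOn
      (fun r : ℝ => (2 * ellipticE r - (1 - r^2) * ellipticK r)^2 *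
        (1 + (π^2 - 4 * (2 * ellipticE r - (1 - r^2) * ellipticK r)^2) / (π^2 * r^2)))
      (Ioo 0 1) ∧
    Tendsto (fun r : ℝ => (2 * ellipticE r - (1 - r^2) * ellipticK r)^2 *
        (1 + (π^2 - 4 * (2 * ellipticE r - (1 - r^2) * ellipticK r)^2) / (π^2 * r^2)))
      (𝓝[>] 0) (𝓝 (π^2/8)) ∧
    Tendsto (fun r : ℝ => (2 * ellipticE r - (1 - r^2) * ellipticK r)^2 *
        (1 + (π^2 - 4 * (2 * ellipticE r - (1 - r^2) * ellipticK r)^2) / (π^2 * r^2)))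
      (𝓝[<] 1) (𝓝 (8 * (π^2 - 8) / π^2)) := by
  rw [F_eq]
  refine ⟨?_, ?_, ?_⟩
  · intro x hx y hy h
    have h1 := hx.1
    have h2 := hy.1
    refine HH_smono ⟨by positivity, ?_⟩ ⟨by positivity, ?_⟩ ?_
    · nlinarith [hx.2]
    · nlinarith [hy.2]
    · nlinarith
  · refine HH_zero.comp (tendsto_nhdsWithin_iff.2 ⟨?_, ?_⟩)
    · have : Continuous (fun r : ℝ => r^2) := by fun_prop
      have := this.tendsto 0
      simp only [ne_eq, OfNat.ofNat_ne_zero, not_false_eq_true, zero_pow] at this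
      exact this.mono_left nhdsWithin_le_nhds
    · filter_upwards [self_mem_nhdsWithin] with x hx
      have : 0 < x := hx
      exact mem_Ioi.2 (by positivity)
  · refine HH_one.comp (tendsto_nhdsWithin_iff.2 ⟨?_, ?_⟩)
    · have : Continuous (fun r : ℝ => r^2) := by fun_prop
      have := this.tendsto 1
      simp only [one_pow] at this
      exact this.mono_left nhdsWithin_le_nhds
    · filter_upwards [Ioo_mem_nhdsLT (show (0:ℝ) < 1 by norm_num)] with x hx
      exact mem_Iio.2 (by nlinarith [hx.1, hx.2])
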